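/- Let (Q, W) arise from a non-degenerate brane tiling satisfying the first consistency condition, fix i_0 ∈ Q̃_0, and identify the set Δ′ of weak-equivalence classes of weak paths in Q̃ starting at i_0 with Q̃_0 × ℤ via (i, k) ↦ ω^k v_i, with Δ corresponding to Q̃_0 × ℕ. Then for any finite ideal Ω ⊂ Δ, setting Ω′ = Ω ∪ (Q̃_0 × ℤ_{<0}) and Ω′_i the set of elements of Ω′ ending at i, the set I(Ω) = { a : i → j in Q̃_1 : ∃ u ∈ Ω′_i with au ∉ Ω′_j } is a perfect matching of the plane tiling defined by Q̃, i.e. every face of Q̃ contains exactly one arrow of I(Ω). -/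

import Mathlib

open scoped Classical

noncomputable section

/-- A quiver, given by a vertex set, an arrow set, and source/target maps. -/
structure Quiv where
  V : Type
  A : Type
  src : A → V
  tgt : A → V

namespace Quiv

/-- Strict paths in a quiver: `Path Q i j` is the type of (directed) paths from
`i` to `j`, built by prepending arrows. -/
inductive Path (Q : Quiv) : Q.V → Q.V → Type
  | nil (i : Q.V) : Path Q i i
  | cons {j : Q.V} (a : Q.A) (p : Path Q (Q.tgt a) j) : Path Q (Q.src a) j

namespace Path

variable {Q : Quiv}

/-- Composition of paths; `p.comp q` traverses `p` first and then `q`.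
(In the algebraic right-to-left notation this is the product `q·p`.) -/
def comp : ∀ {i j k : Q.V}, Path Q i j → Path Q j k → Path Q i k
  | _, _, _, .nil _, q => q
  | _, _, _, .cons a p, q => .cons a (p.comp q)

/-- The path consisting of a single arrow. -/
def single (a : Q.A) : Path Q (Q.src a) (Q.tgt a) := .cons a (.nil _)

/-- Transport a path along equalities of its endpoints. -/
def cast {i i' j j' : Q.V} (hi : i = i') (hj : j = j') (p : Path Q i j) :
    Path Q i' j' := by
  cases hi; cases hj; exact p

/-- The list of arrows traversed by a path (in order of traversal). -/
def arrows : ∀ {i j : Q.V}, Path Q i j → List Q.A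
  | _, _, .nil _ => []
  | _, _, .cons a p => a :: p.arrows

/-- The content of a path: for each arrow, the multiplicity with which it occurs. -/
def content : ∀ {i j : Q.V}, Path Q i j → (Q.A → ℤ)
  | _, _, .nil _ => 0
  | _, _, .cons a p => (fun b => if b = a then 1 else 0) + p.content

end Path

/-- Weak paths in a quiver: formal composites of arrows (`fwd`) and inverses of
arrows (`bwd`). -/
inductive WPath (Q : Quiv) : Q.V → Q.V → Type
  | nil (i : Q.V) : WPath Q i i
  | fwd {j : Q.V} (a : Q.A) (p : WPath Q (Q.tgt a) j) : WPath Q (Q.src a) j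
  | bwd {j : Q.V} (a : Q.A) (p : WPath Q (Q.src a) j) : WPath Q (Q.tgt a) j

namespace WPath

variable {Q : Quiv}

/-- Composition of weak paths: `p.comp q` traverses `p` first and then `q`. -/
def comp : ∀ {i j k : Q.V}, WPath Q i j → WPath Q j k → WPath Q i k
  | _, _, _, .nil _, q => q
  | _, _, _, .fwd a p, q => .fwd a (p.comp q)
  | _, _, _, .bwd a p, q => .bwd a (p.comp q)

/-- Transport a weak path along equalities of its endpoints. -/
def cast {i i' j j' : Q.V} (hi : i = i') (hj : j = j') (p : WPath Q i j) :
    WPath Q i' j' := by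
  cases hi; cases hj; exact p

/-- The formal inverse of a weak path. -/
def reverse : ∀ {i j : Q.V}, WPath Q i j → WPath Q j i
  | _, _, .nil i => .nil i
  | _, _, .fwd a p => p.reverse.comp (.bwd a (.nil _))
  | _, _, .bwd a p => p.reverse.comp (.fwd a (.nil _))

/-- The content of a weak path: each arrow is counted with `+1`, each inverse
arrow with `-1`. -/
def content : ∀ {i j : Q.V}, WPath Q i j → (Q.A → ℤ)
  | _, _, .nil _ => 0
  | _, _, .fwd a p => (fun b => if b = a then 1 else 0) + p.content
  | _, _, .bwd a p => (fun b => if b = a then -1 else 0) + p.content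

/-- Natural number powers of a weak cycle. -/
def npow {i : Q.V} (c : WPath Q i i) : ℕ → WPath Q i i
  | 0 => .nil i
  | n + 1 => c.comp (npow c n)

/-- Integer powers of a weak cycle. -/
def zpow {i : Q.V} (c : WPath Q i i) (k : ℤ) : WPath Q i i :=
  if 0 ≤ k then c.npow k.toNat else c.reverse.npow (-k).toNat

end WPath

/-- The weak path underlying a strict path. -/
def Path.toWeak {Q : Quiv} : ∀ {i j : Q.V}, Path Q i j → WPath Q i j
  | _, _, .nil i => .nil i
  | _, _, .cons a p => .fwd a p.toWeak

/-- A morphism of quivers. -/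
structure Hom (Q Q' : Quiv) where
  onV : Q.V → Q'.V
  onA : Q.A → Q'.A
  src_comm : ∀ a, Q'.src (onA a) = onV (Q.src a)
  tgt_comm : ∀ a, Q'.tgt (onA a) = onV (Q.tgt a)

/-- The image of a strict path under a morphism of quivers. -/
def Path.map {Q Q' : Quiv} (φ : Hom Q Q') :
    ∀ {i j : Q.V}, Path Q i j → Path Q' (φ.onV i) (φ.onV j)
  | _, _, .nil i => .nil _
  | _, _, .cons a p =>
      ((((Path.single (φ.onA a)).cast rfl (φ.tgt_comm a)).comp (p.map φ)).cast
        (φ.src_comm a) rfl)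

/-- The image of a weak path under a morphism of quivers. -/
def WPath.map {Q Q' : Quiv} (φ : Hom Q Q') :
    ∀ {i j : Q.V}, WPath Q i j → WPath Q' (φ.onV i) (φ.onV j)
  | _, _, .nil i => .nil _
  | _, _, .fwd a p =>
      ((WPath.fwd (φ.onA a) ((p.map φ).cast (φ.tgt_comm a).symm rfl)).cast
        (φ.src_comm a) rfl)
  | _, _, .bwd a p =>
      ((WPath.bwd (φ.onA a) ((p.map φ).cast (φ.src_comm a).symm rfl)).cast
        (φ.tgt_comm a) rfl)

/-- The smallest equivalence relation on strict paths which contains `R` and is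
stable under pre- and post-composition with strict paths. -/
inductive PEquiv (Q : Quiv) (R : ∀ ⦃i j : Q.V⦄, Path Q i j → Path Q i j → Prop) :
    ∀ ⦃i j : Q.V⦄, Path Q i j → Path Q i j → Prop
  | base {i j : Q.V} {p q : Path Q i j} : R p q → PEquiv Q R p q
  | refl {i j : Q.V} (p : Path Q i j) : PEquiv Q R p p
  | symm {i j : Q.V} {p q : Path Q i j} : PEquiv Q R p q → PEquiv Q R q p
  | trans {i j : Q.V} {p q r : Path Q i j} :
      PEquiv Q R p q → PEquiv Q R q r → PEquiv Q R p r
  | comp {i j k l : Q.V} (u : Path Q i j) {p q : Path Q j k} (v : Path Q k l) :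
      PEquiv Q R p q → PEquiv Q R (u.comp (p.comp v)) (u.comp (q.comp v))

/-- The smallest equivalence relation on weak paths which contains `R`, contains
the cancellation relations `a a⁻¹ ∼ 1 ∼ a⁻¹ a`, and is stable under pre- and
post-composition with weak paths. -/
inductive WEquiv (Q : Quiv) (R : ∀ ⦃i j : Q.V⦄, WPath Q i j → WPath Q i j → Prop) :
    ∀ ⦃i j : Q.V⦄, WPath Q i j → WPath Q i j → Prop
  | base {i j : Q.V} {p q : WPath Q i j} : R p q → WEquiv Q R p q
  | cancel_fwd (a : Q.A) :
      WEquiv Q R (WPath.fwd a (WPath.bwd a (WPath.nil _))) (WPath.nil _)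
  | cancel_bwd (a : Q.A) :
      WEquiv Q R (WPath.bwd a (WPath.fwd a (WPath.nil _))) (WPath.nil _)
  | refl {i j : Q.V} (p : WPath Q i j) : WEquiv Q R p p
  | symm {i j : Q.V} {p q : WPath Q i j} : WEquiv Q R p q → WEquiv Q R q p
  | trans {i j : Q.V} {p q r : WPath Q i j} :
      WEquiv Q R p q → WEquiv Q R q r → WEquiv Q R p r
  | comp {i j k l : Q.V} (u : WPath Q i j) {p q : WPath Q j k} (v : WPath Q k l) :
      WEquiv Q R p q → WEquiv Q R (u.comp (p.comp v)) (u.comp (q.comp v))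

end Quiv

open Quiv

/-- A brane tiling, encoded through its dual quiver together with its face
structure.  For each arrow `a`, `wface true a` (resp. `wface false a`) is the
complementary path of `a` in the unique positive (resp. negative) face
containing `a`, so that the boundary cycle of that face based at `Q.src a` is
`a` followed by `wface s a`.  The field `rot` expresses that the face cycles
are compatible with rotation, i.e. that the faces are genuine cyclic faces. -/
structure BraneTiling where
  Q : Quiv
  fintV : Fintype Q.V
  fintA : Fintype Q.A
  wface : Bool → ∀ a : Q.A, Quiv.Path Q (Q.tgt a) (Q.src a)
  rot : ∀ (s : Bool) (a b : Q.A) (p : Quiv.Path Q (Q.tgt b) (Q.src a)),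
    HEq (wface s a) (Quiv.Path.cons b p) →
      HEq (wface s b) (p.comp (Quiv.Path.single a))

attribute [instance] BraneTiling.fintV BraneTiling.fintA

namespace BraneTiling

variable (B : BraneTiling)

/-- The boundary cycle, based at `Q.src a`, of the positive (`s = true`) or
negative (`s = false`) face containing the arrow `a`. -/
def faceCycle (s : Bool) (a : B.Q.A) : Path B.Q (B.Q.src a) (B.Q.src a) :=
  Path.cons a (B.wface s a)

/-- `d₂(F)` for the face of sign `s` through `a`: the content of its boundary. -/
def faceContent (s : Bool) (a : B.Q.A) : B.Q.A → ℤ := (B.faceCycle s a).content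

/-- The list of arrows on the boundary of the face of sign `s` through `a`. -/
def cycleArrows (s : Bool) (a : B.Q.A) : List B.Q.A := (B.faceCycle s a).arrows

/-- A perfect matching (of the bipartite graph dual to the quiver): a set of
arrows such that every face contains exactly one arrow of the set. -/
def IsMatching (S : Set B.Q.A) : Prop :=
  ∀ (s : Bool) (a : B.Q.A),
    (B.cycleArrows s a).countP (fun x => decide (x ∈ S)) = 1

/-- The brane tiling is non-degenerate if every edge belongs to some perfect
matching. -/
def NonDegenerate : Prop :=
  ∀ a : B.Q.A, ∃ S : Set B.Q.A, B.IsMatching S ∧ a ∈ S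

/-- The subgroup of `ℤ^{Q₁}` generated by the differences `d₂(F) - d₂(F')` of
the contents of faces. -/
def lamRel : Submodule ℤ (B.Q.A → ℤ) :=
  Submodule.span ℤ
    {x | ∃ (s : Bool) (a : B.Q.A) (t : Bool) (b : B.Q.A),
      x = B.faceContent s a - B.faceContent t b}

/-- The weight group `Λ = ℤ^{Q₁} / ⟨d₂(F) - d₂(F') : F, F' ∈ Q₂⟩`. -/
def Lam : Type := (B.Q.A → ℤ) ⧸ B.lamRel

instance : AddCommGroup B.Lam := by unfold Lam; infer_instance
instance : Module ℤ B.Lam := by unfold Lam; infer_instance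

/-- The weight function `ℤ^{Q₁} → Λ` (the canonical projection). -/
def wt : (B.Q.A → ℤ) →ₗ[ℤ] B.Lam := B.lamRel.mkQ

/-- The weight of a strict path. -/
def wtP {i j : B.Q.V} (p : Path B.Q i j) : B.Lam := B.wt p.content

/-- The weight of a weak path. -/
def wtW {i j : B.Q.V} (p : WPath B.Q i j) : B.Lam := B.wt p.content

/-- The weight of an arrow. -/
def wtA (a : B.Q.A) : B.Lam := B.wt ((Path.single a).content)

/-- The weight `ω̄` of a face cycle (in `Λ` it does not depend on the face). -/
def omegaBarAt (a : B.Q.A) : B.Lam := B.wt (B.faceContent true a)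

end BraneTiling
namespace BraneTiling

variable (B : BraneTiling)

/-- The relations `∂W/∂a`: for each arrow `a`, the complementary path of `a` in
its positive face is identified with the complementary path of `a` in its
negative face. -/
inductive dWRel : ∀ ⦃i j : B.Q.V⦄, Path B.Q i j → Path B.Q i j → Prop
  | mk (a : B.Q.A) : dWRel (B.wface true a) (B.wface false a)

/-- The relations `∂W/∂a`, viewed on weak paths. -/
inductive dWRelW : ∀ ⦃i j : B.Q.V⦄, WPath B.Q i j → WPath B.Q i j → Prop
  | mk (a : B.Q.A) : dWRelW ((B.wface true a).toWeak) ((B.wface false a).toWeak)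

/-- Strict equivalence of paths: the equivalence relation `(∂W)` on strict paths. -/
def SEquiv : ∀ ⦃i j : B.Q.V⦄, Path B.Q i j → Path B.Q i j → Prop :=
  PEquiv B.Q B.dWRel

/-- Weak equivalence of weak paths in `Q`. -/
def WkEquiv : ∀ ⦃i j : B.Q.V⦄, WPath B.Q i j → WPath B.Q i j → Prop :=
  WEquiv B.Q B.dWRelW

end BraneTiling

/-- The periodic quiver `Q̃` of a brane tiling: the inverse image of the quiver
`Q` in the universal cover of the torus, encoded as a covering of quivers with
unique lifting of arrows, together with the lifted face structure. -/
structure Periodic (B : BraneTiling) where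
  tQ : Quiv
  proj : Quiv.Hom tQ B.Q
  liftSrc : ∀ (a : B.Q.A) (i : tQ.V), proj.onV i = B.Q.src a →
    ∃! a' : tQ.A, proj.onA a' = a ∧ tQ.src a' = i
  liftTgt : ∀ (a : B.Q.A) (i : tQ.V), proj.onV i = B.Q.tgt a →
    ∃! a' : tQ.A, proj.onA a' = a ∧ tQ.tgt a' = i
  surjV : Function.Surjective proj.onV
  twface : Bool → ∀ a : tQ.A, Quiv.Path tQ (tQ.tgt a) (tQ.src a)
  proj_twface : ∀ (s : Bool) (a : tQ.A),
    (twface s a).map proj =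
      (B.wface s (proj.onA a)).cast (proj.tgt_comm a) (proj.src_comm a)

namespace Periodic

variable {B : BraneTiling} (P : Periodic B)

/-- The boundary cycle, based at `src a`, of the face of sign `s` of the
periodic quiver containing the arrow `a`. -/
def faceCycle (s : Bool) (a : P.tQ.A) : Path P.tQ (P.tQ.src a) (P.tQ.src a) :=
  Path.cons a (P.twface s a)

/-- Pairs of boundary cycles of faces of the periodic quiver with the same
endpoints. -/
inductive faceRel : ∀ ⦃i j : P.tQ.V⦄, WPath P.tQ i j → WPath P.tQ i j → Prop
  | mk (s t : Bool) (a b : P.tQ.A) (h : P.tQ.src b = P.tQ.src a) :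
      faceRel ((P.faceCycle s a).toWeak) (((P.faceCycle t b).toWeak).cast h h)

/-- Weak equivalence of weak paths in the periodic quiver: the equivalence
relation generated by identifying any two boundary cycles of faces with the
same endpoints (stable under composition). -/
def WkEquiv : ∀ ⦃i j : P.tQ.V⦄, WPath P.tQ i j → WPath P.tQ i j → Prop :=
  WEquiv P.tQ P.faceRel

/-- The weight of a weak path of the periodic quiver. -/
def wtW {i j : P.tQ.V} (u : WPath P.tQ i j) : B.Lam := B.wt ((u.map P.proj).content)

/-- The weight of a strict path of the periodic quiver. -/
def wtP {i j : P.tQ.V} (u : Path P.tQ i j) : B.Lam := B.wt ((u.map P.proj).content)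

/-- A strict path `u : i → j` of the periodic quiver is a shortest path if any
strict path from `i` to `j` is weakly equivalent to `u ω^k` for some `k ≥ 0`. -/
def Shortest {i j : P.tQ.V} (u : Path P.tQ i j) : Prop :=
  ∀ p : Path P.tQ i j, ∃ (s : Bool) (a : P.tQ.A) (h : P.tQ.src a = i) (k : ℕ),
    P.WkEquiv p.toWeak
      (((((P.faceCycle s a).toWeak).npow k).cast h h).comp u.toWeak)

end Periodic

/-- The first consistency condition: two paths in `Q` with the same startpoint
are strictly equivalent if and only if their weights are equal. -/
def BraneTiling.Consistent1 (B : BraneTiling) : Prop :=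
  ∀ (i j j' : B.Q.V) (u : Quiv.Path B.Q i j) (v : Quiv.Path B.Q i j'),
    (∃ h : j = j', B.SEquiv (u.cast rfl h) v) ↔ B.wtP u = B.wtP v

/-- The second consistency condition: every shortest path of the periodic
quiver can be extended by an arrow at its target (and, dually, at its source)
to a shortest path. -/
def Periodic.Consistent2 {B : BraneTiling} (P : Periodic B) : Prop :=
  ∀ (i j : P.tQ.V) (u : Quiv.Path P.tQ i j), P.Shortest u →
    (∃ (a : P.tQ.A) (h : P.tQ.src a = j),
      P.Shortest (u.comp ((Quiv.Path.single a).cast h rfl))) ∧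
    (∃ (b : P.tQ.A) (h : P.tQ.tgt b = i),
      P.Shortest (((Quiv.Path.single b).cast rfl h).comp u))

namespace Periodic

variable {B : BraneTiling} (P : Periodic B)

/-- A perfect matching of the plane tiling defined by the periodic quiver: a
set of arrows such that every face of `Q̃` contains exactly one arrow of it. -/
def IsMatching (S : Set P.tQ.A) : Prop :=
  ∀ (s : Bool) (a : P.tQ.A),
    ((P.faceCycle s a).arrows).countP (fun x => decide (x ∈ S)) = 1

end Periodic

/-- The identification of the poset `Δ = Δ_{i₀}` of weak-equivalence classes of
strict paths of `Q̃` starting at `i₀` with `Q̃₀ × ℕ`, and of the set `Δ′` of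
classes of weak paths starting at `i₀` with `Q̃₀ × ℤ`:  it consists of a face
cycle `ω` based at `i₀`, a shortest path `v i : i₀ → i` for every vertex `i`,
and the class function `cl` assigning to a weak path `u : i₀ → j` the unique
`k ∈ ℤ` with `u ∼ ω^k v_j`. -/
structure DeltaData (B : BraneTiling) (P : Periodic B) (i0 : P.tQ.V) where
  omega : Quiv.Path P.tQ i0 i0
  omega_isFace : ∃ (s : Bool) (a : P.tQ.A) (h : P.tQ.src a = i0),
    omega = (P.faceCycle s a).cast h h
  v : ∀ i : P.tQ.V, Quiv.Path P.tQ i0 i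
  v_shortest : ∀ i, P.Shortest (v i)
  cl : ∀ {j : P.tQ.V}, Quiv.WPath P.tQ i0 j → ℤ
  cl_spec : ∀ (j : P.tQ.V) (u : Quiv.WPath P.tQ i0 j),
    P.WkEquiv u ((omega.toWeak.zpow (cl u)).comp (v j).toWeak)
  cl_congr : ∀ (j : P.tQ.V) (u u' : Quiv.WPath P.tQ i0 j),
    P.WkEquiv u u' → cl u = cl u'

namespace DeltaData

variable {B : BraneTiling} {P : Periodic B} {i0 : P.tQ.V} (D : DeltaData B P i0)

/-- The weak path `ω^k v_i` representing the class `(i, k) ∈ Q̃₀ × ℤ = Δ′`. -/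
def el (i : P.tQ.V) (k : ℤ) : Quiv.WPath P.tQ i0 i :=
  (D.omega.toWeak.zpow k).comp (D.v i).toWeak

/-- The partial order on `Δ′ = Q̃₀ × ℤ`: `x ≤ y` iff there is a strict path `w`
with `w·x ∼ y`. -/
def le (x y : P.tQ.V × ℤ) : Prop :=
  ∃ w : Quiv.Path P.tQ x.1 y.1, D.cl ((D.el x.1 x.2).comp w.toWeak) = y.2

/-- Finite ideals of the poset `Δ = Q̃₀ × ℕ`: finite downward closed subsets. -/
def IsIdeal (Ω : Finset (P.tQ.V × ℕ)) : Prop :=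
  ∀ y ∈ Ω, ∀ (i : P.tQ.V) (k : ℕ),
    D.le (i, (k : ℤ)) (y.1, (y.2 : ℤ)) → (i, k) ∈ Ω

/-- Membership in `Ω′ = Ω ∪ (Q̃₀ × ℤ_{<0}) ⊆ Δ′`. -/
def memOm' (_D : DeltaData B P i0) (Ω : Finset (P.tQ.V × ℕ)) (x : P.tQ.V × ℤ) : Prop :=
  x.2 < 0 ∨ (0 ≤ x.2 ∧ (x.1, x.2.toNat) ∈ Ω)

/-- The set of arrows `I(Ω) = { a : i → j | ∃ u ∈ Ω′_i, au ∉ Ω′_j }`. -/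
def matchOf (Ω : Finset (P.tQ.V × ℕ)) : Set P.tQ.A :=
  {a | ∃ k : ℤ, D.memOm' Ω (P.tQ.src a, k) ∧
    ¬ D.memOm' Ω (P.tQ.tgt a,
      D.cl ((D.el (P.tQ.src a) k).comp (Quiv.Path.single a).toWeak))}

end DeltaData

namespace Quiv

variable {Q Q' : Quiv}

/-- The total `f`-weight of the arrows of a strict path. -/
def Path.deg (f : Q.A → ℤ) : ∀ {i j : Q.V}, Path Q i j → ℤ
  | _, _, .nil _ => 0
  | _, _, .cons a p => f a + p.deg f

/-- The total `f`-weight of a weak path, inverse arrows being counted negatively. -/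
def WPath.deg (f : Q.A → ℤ) : ∀ {i j : Q.V}, WPath Q i j → ℤ
  | _, _, .nil _ => 0
  | _, _, .fwd a p => f a + p.deg f
  | _, _, .bwd a p => -f a + p.deg f

namespace Path

theorem deg_comp (f : Q.A → ℤ) {i j k : Q.V} (p : Path Q i j) (q : Path Q j k) :
    (p.comp q).deg f = p.deg f + q.deg f := by
  induction p with
  | nil => simp [comp, deg]
  | cons a p ih => simp [comp, deg, ih, add_assoc]

theorem deg_single (f : Q.A → ℤ) (a : Q.A) : (single a).deg f = f a := by
  simp [single, deg]

theorem deg_cast (f : Q.A → ℤ) {i i' j j' : Q.V} (hi : i = i') (hj : j = j')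
    (p : Path Q i j) : (p.cast hi hj).deg f = p.deg f := by
  cases hi; cases hj; rfl

theorem deg_toWeak (f : Q.A → ℤ) {i j : Q.V} (p : Path Q i j) :
    p.toWeak.deg f = p.deg f := by
  induction p with
  | nil => rfl
  | cons a p ih => simp [toWeak, deg, WPath.deg, ih]

theorem toWeak_comp {i j k : Q.V} (p : Path Q i j) (q : Path Q j k) :
    (p.comp q).toWeak = p.toWeak.comp q.toWeak := by
  induction p with
  | nil => rfl
  | cons a p ih => simp [toWeak, comp, WPath.comp, ih]

theorem deg_map (φ : Hom Q Q') (g : Q'.A → ℤ) {i j : Q.V} (p : Path Q i j) :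
    (p.map φ).deg g = p.deg (fun a => g (φ.onA a)) := by
  induction p with
  | nil => rfl
  | cons a p ih => simp [map, deg_cast, deg_comp, deg_single, deg, ih]

/-- The weight of an indicator function counts the arrows of a path in a set. -/
theorem deg_indicator (S : Set Q.A) {i j : Q.V} (p : Path Q i j) :
    p.deg (fun a => if a ∈ S then 1 else 0) =
      (p.arrows.countP (fun x => decide (x ∈ S)) : ℤ) := by
  induction p with
  | nil => rfl
  | cons a p ih =>
    by_cases h : a ∈ S <;> simp [deg, arrows, h, ih, add_comm]

/-- Changing the weight by the coboundary of `φ` changes the degree by the difference of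
the values of `φ` at the endpoints. -/
theorem deg_add_coboundary (φ : Q.V → ℤ) (f : Q.A → ℤ) {i j : Q.V} (p : Path Q i j) :
    p.deg (fun a => φ (Q.src a) + f a - φ (Q.tgt a)) = φ i + p.deg f - φ j := by
  induction p with
  | nil => simp [deg]
  | cons a p ih => simp only [deg, ih]; ring

theorem countP_le_deg (e : Q.A → ℤ) (he : ∀ a, 0 ≤ e a) (S : Set Q.A)
    (hS : ∀ a, a ∈ S ↔ 0 < e a) {i j : Q.V} (p : Path Q i j) :
    (p.arrows.countP (fun x => decide (x ∈ S)) : ℤ) ≤ p.deg e := by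
  induction p with
  | nil => simp [deg, arrows]
  | cons a p ih =>
    have := he a
    have := hS a
    by_cases h : a ∈ S <;> simp [deg, arrows, h] <;> grind

theorem deg_eq_zero_of_countP (e : Q.A → ℤ) (he : ∀ a, 0 ≤ e a) (S : Set Q.A)
    (hS : ∀ a, a ∈ S ↔ 0 < e a) {i j : Q.V} (p : Path Q i j)
    (hp : p.arrows.countP (fun x => decide (x ∈ S)) = 0) : p.deg e = 0 := by
  induction p with
  | nil => rfl
  | cons a p ih =>
    have := he a
    have := hS a
    by_cases h : a ∈ S
    · simp [arrows, h] at hp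
    · have := ih (by simpa [arrows, h] using hp)
      simp only [deg]
      grind

end Path

namespace WPath

theorem deg_comp (f : Q.A → ℤ) {i j k : Q.V} (p : WPath Q i j) (q : WPath Q j k) :
    (p.comp q).deg f = p.deg f + q.deg f := by
  induction p with
  | nil => simp [comp, deg]
  | fwd a p ih => simp [comp, deg, ih, add_assoc]
  | bwd a p ih => simp [comp, deg, ih, add_assoc]

theorem deg_cast (f : Q.A → ℤ) {i i' j j' : Q.V} (hi : i = i') (hj : j = j')
    (p : WPath Q i j) : (p.cast hi hj).deg f = p.deg f := by
  cases hi; cases hj; rfl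

theorem deg_reverse (f : Q.A → ℤ) {i j : Q.V} (p : WPath Q i j) :
    p.reverse.deg f = -p.deg f := by
  induction p with
  | nil => rfl
  | fwd a p ih => simp [reverse, deg_comp, deg, ih]
  | bwd a p ih => simp [reverse, deg_comp, deg, ih]

theorem deg_npow (f : Q.A → ℤ) {i : Q.V} (c : WPath Q i i) (n : ℕ) :
    (c.npow n).deg f = n * c.deg f := by
  induction n with
  | zero => simp [npow, deg]
  | succ n ih => simp only [npow, deg_comp, ih]; push_cast; ring

theorem deg_zpow (f : Q.A → ℤ) {i : Q.V} (c : WPath Q i i) (k : ℤ) :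
    (c.zpow k).deg f = k * c.deg f := by
  unfold zpow
  split_ifs with h
  · rw [deg_npow, Int.toNat_of_nonneg h]
  · rw [deg_npow, deg_reverse, Int.toNat_of_nonneg (by omega)]; ring

end WPath

/-- A weight that agrees on both sides of each relation is a weak-equivalence invariant. -/
theorem WEquiv.deg_eq {R : ∀ ⦃i j : Q.V⦄, WPath Q i j → WPath Q i j → Prop} (f : Q.A → ℤ)
    (hR : ∀ ⦃i j : Q.V⦄ (p q : WPath Q i j), R p q → p.deg f = q.deg f)
    {i j : Q.V} {p q : WPath Q i j} (h : WEquiv Q R p q) : p.deg f = q.deg f := by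
  induction h with
  | base h => exact hR _ _ h
  | cancel_fwd a => simp [WPath.deg]
  | cancel_bwd a => simp [WPath.deg]
  | refl p => rfl
  | symm _ ih => exact ih.symm
  | trans _ _ ih₁ ih₂ => exact ih₁.trans ih₂
  | comp u v _ ih => simp [WPath.deg_comp, ih]

end Quiv

namespace Periodic

variable {B : BraneTiling} (P : Periodic B)

/-- A perfect matching of the brane tiling gives a weight on the periodic quiver for which
every face has degree one. -/
theorem deg_faceCycle {S : Set B.Q.A} (hS : B.IsMatching S) (s : Bool) (a : P.tQ.A) :
    (P.faceCycle s a).deg (fun b => if P.proj.onA b ∈ S then 1 else 0) = 1 := by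
  have h := hS s (P.proj.onA a)
  rw [BraneTiling.cycleArrows] at h
  have h' := Path.deg_indicator S (B.faceCycle s (P.proj.onA a))
  rw [h, BraneTiling.faceCycle, Path.deg] at h'
  have hm := Path.deg_map P.proj (fun b => if b ∈ S then (1 : ℤ) else 0) (P.twface s a)
  rw [P.proj_twface, Path.deg_cast] at hm
  rw [faceCycle, Path.deg, ← hm]
  simpa using h'

variable {P} {f : P.tQ.A → ℤ}

theorem WkEquiv.deg_eq (hf : ∀ s a, (P.faceCycle s a).deg f = 1) {i j : P.tQ.V}
    {p q : WPath P.tQ i j} (h : P.WkEquiv p q) : p.deg f = q.deg f := by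
  refine WEquiv.deg_eq f ?_ h
  rintro i j p q ⟨s, t, a, b, hab⟩
  rw [WPath.deg_cast, Path.deg_toWeak, Path.deg_toWeak, hf, hf]

/-- Shortest paths minimise the degree among strict paths with the same endpoints. -/
theorem Shortest.deg_le (hf : ∀ s a, (P.faceCycle s a).deg f = 1) {i j : P.tQ.V}
    {u : Path P.tQ i j} (hu : P.Shortest u) (p : Path P.tQ i j) : u.deg f ≤ p.deg f := by
  obtain ⟨s, a, h, k, hk⟩ := hu p
  have := WkEquiv.deg_eq hf hk
  rw [WPath.deg_comp, WPath.deg_cast, WPath.deg_npow, Path.deg_toWeak, Path.deg_toWeak,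
    Path.deg_toWeak, hf] at this
  omega

end Periodic

namespace DeltaData

variable {B : BraneTiling} {P : Periodic B} {i0 : P.tQ.V} (D : DeltaData B P i0)
  {f : P.tQ.A → ℤ}

theorem deg_el (hf : ∀ s a, (P.faceCycle s a).deg f = 1) (i : P.tQ.V) (k : ℤ) :
    (D.el i k).deg f = k + (D.v i).deg f := by
  obtain ⟨s, a, h, ho⟩ := D.omega_isFace
  rw [el, WPath.deg_comp, WPath.deg_zpow, Path.deg_toWeak, Path.deg_toWeak, ho,
    Path.deg_cast, hf, mul_one]

theorem cl_eq (hf : ∀ s a, (P.faceCycle s a).deg f = 1) {j : P.tQ.V}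
    (u : WPath P.tQ i0 j) : D.cl u = u.deg f - (D.v j).deg f := by
  have h := Periodic.WkEquiv.deg_eq hf (D.cl_spec j u)
  have h' := D.deg_el hf j (D.cl u)
  rw [el] at h'
  omega

theorem cl_el_comp (hf : ∀ s a, (P.faceCycle s a).deg f = 1) {i j : P.tQ.V} (k : ℤ)
    (w : Path P.tQ i j) : D.cl ((D.el i k).comp w.toWeak) =
      k + ((D.v i).deg f + w.deg f - (D.v j).deg f) := by
  rw [D.cl_eq hf, WPath.deg_comp, D.deg_el hf, Path.deg_toWeak]
  ring

/-- `Ω′` is downward closed in `Δ′`. -/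
theorem memOm'_of_path (hf : ∀ s a, (P.faceCycle s a).deg f = 1)
    {Ω : Finset (P.tQ.V × ℕ)} (hΩ : D.IsIdeal Ω) {i j : P.tQ.V} (w : Path P.tQ i j) (k : ℤ)
    (h : D.memOm' Ω (j, k + ((D.v i).deg f + w.deg f - (D.v j).deg f))) :
    D.memOm' Ω (i, k) := by
  by_cases hk : k < 0
  · exact Or.inl hk
  push Not at hk
  have hn := (D.v_shortest j).deg_le hf ((D.v i).comp w)
  rw [Path.deg_comp] at hn
  obtain h | ⟨h0, h⟩ := h
  · simp only at h
    omega
  · refine Or.inr ⟨hk, hΩ _ h i k.toNat ⟨w, ?_⟩⟩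
    simp only [Int.toNat_of_nonneg hk, Int.toNat_of_nonneg h0]
    exact D.cl_el_comp hf k w

/-- `Ω′_i` has a greatest element. -/
theorem exists_greatest_memOm' (Ω : Finset (P.tQ.V × ℕ)) (i : P.tQ.V) :
    ∃ m : ℤ, D.memOm' Ω (i, m) ∧ ∀ k, D.memOm' Ω (i, k) → k ≤ m := by
  refine Int.exists_greatest_of_bdd (P := fun k => D.memOm' Ω (i, k))
    ⟨(Ω.sup Prod.snd : ℕ), ?_⟩ ⟨-1, Or.inl (by norm_num)⟩
  rintro k (h | ⟨h0, h⟩)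
  · simp only at h
    omega
  · have := Finset.le_sup (f := Prod.snd) h
    simp only at this h0
    omega

theorem memOm'_tgt_of_le (hf : ∀ s a, (P.faceCycle s a).deg f = 1)
    {Ω : Finset (P.tQ.V × ℕ)} (hΩ : D.IsIdeal Ω) (a : P.tQ.A) {k m : ℤ} (hkm : k ≤ m)
    (hm : D.memOm' Ω (P.tQ.tgt a, m)) : D.memOm' Ω (P.tQ.tgt a, k) := by
  induction k, hkm using Int.leInductionDown with
  | base => exact hm
  | pred k _ ih =>
    refine D.memOm'_of_path hf hΩ ((P.twface true a).comp (Path.single a)) (k - 1) ?_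
    have h1 := hf true a
    rw [Periodic.faceCycle, Path.deg] at h1
    rw [Path.deg_comp, Path.deg_single]
    convert ih using 2
    omega

end DeltaData

/-- Let `(Q, W)` arise from a non-degenerate brane tiling
satisfying the first consistency condition, fix `i₀ ∈ Q̃₀`, and identify the
set `Δ′` of weak-equivalence classes of weak paths in `Q̃` starting at `i₀`
with `Q̃₀ × ℤ` via `(i, k) ↦ ω^k v_i` (the data `D`), with `Δ` corresponding to
`Q̃₀ × ℕ`.  Then for any finite ideal `Ω ⊆ Δ`, setting
`Ω′ = Ω ∪ (Q̃₀ × ℤ_{<0})` and `Ω′_i` the set of elements of `Ω′` ending at `i`,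
the set `I(Ω) = { a : i → j ∈ Q̃₁ | ∃ u ∈ Ω′_i with au ∉ Ω′_j }` is a perfect
matching of the plane tiling defined by `Q̃`, i.e. every face of `Q̃` contains
exactly one arrow of `I(Ω)`. -/
theorem matchOf_isMatching (B : BraneTiling) (hB : B.NonDegenerate)
    (hc : B.Consistent1) (P : Periodic B) (i0 : P.tQ.V)
    (D : DeltaData B P i0) (Ω : Finset (P.tQ.V × ℕ)) (hΩ : D.IsIdeal Ω) :
    P.IsMatching (D.matchOf Ω) := by
  obtain ⟨_, a₀, _, _⟩ := D.omega_isFace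
  obtain ⟨S, hS, _⟩ := hB (P.proj.onA a₀)
  have hf := P.deg_faceCycle hS
  set f : P.tQ.A → ℤ := fun b => if P.proj.onA b ∈ S then 1 else 0
  choose m hm hmax using D.exists_greatest_memOm' Ω
  set φ : P.tQ.V → ℤ := fun i => m i + (D.v i).deg f with hφ
  set e : P.tQ.A → ℤ := fun a => φ (P.tQ.src a) + f a - φ (P.tQ.tgt a) with he
  have he0 : ∀ a, 0 ≤ e a := fun a => by
    have h := hmax _ _ (D.memOm'_of_path hf hΩ (Path.single a)
      (m (P.tQ.tgt a) - ((D.v (P.tQ.src a)).deg f + f a - (D.v (P.tQ.tgt a)).deg f))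
      (by rw [Path.deg_single, sub_add_cancel]; exact hm _))
    simp only [he, hφ]
    omega
  have hmem : ∀ a, a ∈ D.matchOf Ω ↔ 0 < e a := fun a => by
    simp only [DeltaData.matchOf, Set.mem_ofPred_eq, D.cl_el_comp hf, Path.deg_single, he, hφ]
    constructor
    · rintro ⟨k, hk, hk'⟩
      by_contra hlt
      have := hmax _ _ hk
      exact hk' (D.memOm'_tgt_of_le hf hΩ a (by omega) (hm _))
    · intro h
      refine ⟨m (P.tQ.src a), hm _, fun h' => ?_⟩
      have := hmax _ _ h'
      omega
  intro s a
  have hdeg : (P.faceCycle s a).deg e = 1 := by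
    rw [he, Path.deg_add_coboundary, hf]
    ring
  have hle := Path.countP_le_deg e he0 _ hmem (P.faceCycle s a)
  have hne := mt (Path.deg_eq_zero_of_countP e he0 _ hmem (P.faceCycle s a)) (by omega)
  omega
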